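/- In S(F₃;ℂ), with γ = g₂g₁⁻¹g₃g₁g₃⁻¹ and δ = g₁⁻¹g₃g₁g₃⁻¹g₂, one has Φ(Q) = [γg₁] − [δg₁], where Q = 2x₁₃x₂₃ − 2x₃x₁₂₃ + x₁²x₃x₁₂₃ − x₁x₃x₁₂x₁₃ − x₁x₃x₂₃ − x₁x₁₃x₁₂₃ + x₁₂x₁₃² + x₃²x₁₂. -/

import Mathlib

open MvPolynomial

noncomputable section

def skeinIdeal (R G : Type*) [CommRing R] [Group G] : Ideal (MvPolynomial G R) :=
  Ideal.span ({X (1 : G) - 2} ∪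
    {p | ∃ g h : G, p = X g * X h - X (g * h) - X (g * h⁻¹)})

abbrev SkeinAlgebra (R G : Type*) [CommRing R] [Group G] :=
  MvPolynomial G R ⧸ skeinIdeal R G

def cl (R : Type*) {G : Type*} [CommRing R] [Group G] (g : G) : SkeinAlgebra R G :=
  Ideal.Quotient.mk (skeinIdeal R G) (X g)

/-- The free group on three generators. -/
abbrev F3 := FreeGroup (Fin 3)

def g1 : F3 := FreeGroup.of 0
def g2 : F3 := FreeGroup.of 1
def g3 : F3 := FreeGroup.of 2

/-- The words `g₁, g₂, g₃, g₁g₂, g₁g₃, g₂g₃, g₁g₂g₃` indexed by the seven variables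
`x₁, x₂, x₃, x₁₂, x₁₃, x₂₃, x₁₂₃`. -/
def word : Fin 7 → F3 := ![g1, g2, g3, g1 * g2, g1 * g3, g2 * g3, g1 * g2 * g3]

/-- `Φ : ℂ[x₁,…,x₁₂₃] → S(F₃;ℂ)`, `x_{i₁⋯i_k} ↦ [g_{i₁}⋯g_{i_k}]`. -/
def Phi : MvPolynomial (Fin 7) ℂ →ₐ[ℂ] SkeinAlgebra ℂ F3 :=
  aeval fun i => cl ℂ (word i)

-- the seven variables
def x1 : MvPolynomial (Fin 7) ℂ := X 0
def x2 : MvPolynomial (Fin 7) ℂ := X 1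
def x3 : MvPolynomial (Fin 7) ℂ := X 2
def x12 : MvPolynomial (Fin 7) ℂ := X 3
def x13 : MvPolynomial (Fin 7) ℂ := X 4
def x23 : MvPolynomial (Fin 7) ℂ := X 5
def x123 : MvPolynomial (Fin 7) ℂ := X 6

/-- The polynomial `K`. -/
def K : MvPolynomial (Fin 7) ℂ :=
  x123 ^ 2 - (x12 * x3 + x13 * x2 + x23 * x1 - x1 * x2 * x3) * x123
    + x1 ^ 2 + x2 ^ 2 + x3 ^ 2 + x12 ^ 2 + x23 ^ 2 + x13 ^ 2
    - x1 * x2 * x12 - x1 * x3 * x13 - x2 * x3 * x23 + x12 * x13 * x23 - 4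

def rgamma : F3 := g2 * g1⁻¹ * g3 * g1 * g3⁻¹
def rdelta : F3 := g1⁻¹ * g3 * g1 * g3⁻¹ * g2

def Q : MvPolynomial (Fin 7) ℂ :=
  2*x13*x23 - 2*x3*x123 + x1^2*x3*x123 - x1*x3*x12*x13 - x1*x3*x23
    - x1*x13*x123 + x12*x13^2 + x3^2*x12

section Skein

variable {R G : Type*} [CommRing R] [Group G]

theorem cl_one : cl R (1 : G) = 2 := by
  have h : (X (1 : G) - 2 : MvPolynomial G R) ∈ skeinIdeal R G :=
    Ideal.subset_span (Or.inl rfl)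
  have h₀ := Ideal.Quotient.eq_zero_iff_mem.mpr h
  rw [map_sub, map_ofNat, sub_eq_zero] at h₀
  exact h₀

theorem cl_mul_cl (g h : G) : cl R g * cl R h = cl R (g * h) + cl R (g * h⁻¹) := by
  have hm : (X g * X h - X (g * h) - X (g * h⁻¹) : MvPolynomial G R) ∈ skeinIdeal R G :=
    Ideal.subset_span (Or.inr ⟨g, h, rfl⟩)
  have := Ideal.Quotient.eq_zero_iff_mem.mpr hm
  simp only [map_sub, map_mul] at this
  simp only [cl]
  linear_combination this

theorem cl_inv (g : G) : cl R g⁻¹ = cl R g := by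
  have h := cl_mul_cl (R := R) 1 g
  simp only [one_mul, cl_one] at h
  linear_combination -h

theorem cl_mul_comm (g h : G) : cl R (g * h) = cl R (h * g) := by
  have h₁ := cl_mul_cl (R := R) g h
  have h₂ := cl_mul_cl (R := R) h g
  have h₃ := cl_inv (R := R) (g * h⁻¹)
  rw [mul_inv_rev, inv_inv] at h₃
  linear_combination h₂ - h₁ + h₃

theorem cl_mul_inv (g h : G) : cl R (g * h⁻¹) = cl R g * cl R h - cl R (g * h) := by
  rw [cl_mul_cl, add_sub_cancel_left]

theorem cl_mul_mul_self (g h : G) : cl R (g * h * h) = cl R (g * h) * cl R h - cl R g := by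
  rw [cl_mul_cl, mul_inv_cancel_right, add_sub_cancel_right]

/-- The sum of the classes of the two cyclic orderings of three elements. -/
theorem cl_triple_add (a b c : G) :
    cl R (a * c * b) + cl R (a * b * c) =
      cl R (a * b) * cl R c + cl R (a * c) * cl R b + cl R (b * c) * cl R a
        - cl R a * cl R b * cl R c := by
  have h₁ := cl_mul_inv (R := R) (a * b) c
  have h₂ := cl_mul_inv (R := R) (c * b⁻¹) a
  have h₃ := cl_mul_inv (R := R) c b
  have h₄ := cl_mul_inv (R := R) (a * c) b
  have h₅ : cl R (a * b * c⁻¹) = cl R (c * b⁻¹ * a⁻¹) := by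
    rw [← cl_inv]; simp [mul_assoc]
  have h₆ : cl R (c * b⁻¹ * a) = cl R (a * c * b⁻¹) := by
    rw [cl_mul_comm, mul_assoc]
  rw [cl_mul_comm c b] at h₃
  linear_combination h₁ - h₂ - cl R a * h₃ + h₄ - h₅ + h₆

/-- The class of `a * b * a * c`. -/
theorem cl_mul_mul_mul_left (a b c : G) :
    cl R (a * b * (a * c)) =
      cl R (a * b) * cl R (a * c) - cl R b * cl R c + cl R (b * c) := by
  have h₁ := cl_mul_cl (R := R) (a * b) (a * c)
  have h₂ : cl R (a * b * (a * c)⁻¹) = cl R (b * c⁻¹) := by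
    rw [mul_assoc, cl_mul_comm]; simp [mul_assoc]
  have h₃ := cl_mul_inv (R := R) b c
  linear_combination -h₁ - h₂ - h₃

/-- The class of `c * a * c⁻¹ * b`, a product of `b` with a conjugate of `a`. -/
theorem cl_conj_mul (a b c : G) :
    cl R (c * a * c⁻¹ * b) =
      cl R (a * b * c) * cl R c - cl R (a * c) * cl R (b * c)
        + cl R a * cl R b - cl R (a * b) := by
  have h₁ : cl R (c * a * c⁻¹ * b) = cl R (b * c * a * c⁻¹) := by
    rw [cl_mul_comm]; simp only [mul_assoc]
  have h₂ := cl_mul_inv (R := R) (b * c * a) c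
  have h₃ : cl R (b * c * a) = cl R (a * b * c) := by
    rw [cl_mul_comm]; simp only [mul_assoc]
  have h₄ : cl R (b * c * a * c) = cl R (c * b * (c * a)) := by
    rw [cl_mul_comm]; simp only [mul_assoc]
  have h₅ := cl_mul_mul_mul_left (R := R) c b a
  rw [cl_mul_comm c b, cl_mul_comm c a, cl_mul_comm b a] at h₅
  rw [h₃] at h₂
  linear_combination h₁ + h₂ - h₄ - h₅

end Skein

theorem phi_Q_gamma_g1 : Phi Q = cl ℂ (rgamma * g1) - cl ℂ (rdelta * g1) := by
  have hγ : cl ℂ (rgamma * g1) = cl ℂ (g3 * g1 * g3⁻¹ * (g1 * g2 * g1⁻¹)) := by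
    have h : rgamma * g1 = g2 * g1⁻¹ * (g3 * g1 * g3⁻¹ * g1) := by
      simp only [rgamma, mul_assoc]
    rw [h, cl_mul_comm]; simp only [mul_assoc]
  have hδ : cl ℂ (rdelta * g1) = cl ℂ (g3 * g1 * g3⁻¹ * g2) := by
    have h : rdelta * g1 = g1⁻¹ * (g3 * g1 * g3⁻¹ * g2 * g1) := by
      simp only [rdelta, mul_assoc]
    rw [h, cl_mul_comm, mul_inv_cancel_right]
  have hb : cl ℂ (g1 * g2 * g1⁻¹) = cl ℂ g2 := by
    rw [mul_assoc, cl_mul_comm, inv_mul_cancel_right]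
  have hab : cl ℂ (g1 * (g1 * g2 * g1⁻¹)) = cl ℂ (g1 * g2) := by
    rw [← mul_assoc, ← mul_assoc, cl_mul_comm, ← mul_assoc, ← mul_assoc, inv_mul_cancel, one_mul]
  have h231 : cl ℂ (g2 * g3 * g1) = cl ℂ (g1 * g2 * g3) := by
    rw [cl_mul_comm, mul_assoc]
  have hbc := cl_conj_mul (R := ℂ) g2 g3 g1
  rw [h231, cl_mul_comm g2 g1, cl_mul_comm g3 g1] at hbc
  have habc : cl ℂ (g1 * (g1 * g2 * g1⁻¹) * g3) =
      cl ℂ g1 * cl ℂ (g1 * g2 * g1⁻¹ * g3) - cl ℂ (g2 * g3) * cl ℂ g1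
        + cl ℂ (g1 * g3 * g2) := by
    have h₁ := cl_mul_mul_self (R := ℂ) (g2 * g1⁻¹ * g3) g1
    have h₂ : cl ℂ (g1 * g2 * g1⁻¹ * g3) = cl ℂ (g2 * g1⁻¹ * g3 * g1) := by
      rw [cl_mul_comm _ g1]; simp only [mul_assoc]
    have h₃ : cl ℂ (g1 * (g1 * g2 * g1⁻¹) * g3) = cl ℂ (g2 * g1⁻¹ * g3 * g1 * g1) := by
      rw [mul_assoc _ g1 g1, cl_mul_comm _ (g1 * g1)]; simp only [mul_assoc]
    have h₄ : cl ℂ (g2 * g1⁻¹ * g3) = cl ℂ (g3 * g2 * g1⁻¹) := by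
      rw [cl_mul_comm _ g3, mul_assoc g3]
    have h₅ := cl_mul_inv (R := ℂ) (g3 * g2) g1
    have h₆ : cl ℂ (g3 * g2 * g1) = cl ℂ (g1 * g3 * g2) := by
      rw [cl_mul_comm, mul_assoc]
    rw [cl_mul_comm g3 g2] at h₅
    linear_combination h₃ + h₁ - cl ℂ g1 * h₂ - h₄ - h₅ + h₆
  have hsum := cl_triple_add (R := ℂ) g1 g2 g3
  have hPhi : Phi Q =
      2 * cl ℂ (g1 * g3) * cl ℂ (g2 * g3) - 2 * cl ℂ g3 * cl ℂ (g1 * g2 * g3)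
        + cl ℂ g1 ^ 2 * cl ℂ g3 * cl ℂ (g1 * g2 * g3)
        - cl ℂ g1 * cl ℂ g3 * cl ℂ (g1 * g2) * cl ℂ (g1 * g3)
        - cl ℂ g1 * cl ℂ g3 * cl ℂ (g2 * g3) - cl ℂ g1 * cl ℂ (g1 * g3) * cl ℂ (g1 * g2 * g3)
        + cl ℂ (g1 * g2) * cl ℂ (g1 * g3) ^ 2 + cl ℂ g3 ^ 2 * cl ℂ (g1 * g2) := by
    simp only [Phi, Q, x1, x3, x12, x13, x23, x123, map_add, map_sub, map_mul, map_pow,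
      map_ofNat, aeval_X]
    rfl
  rw [hPhi, hγ, hδ, cl_conj_mul g1 (g1 * g2 * g1⁻¹) g3, cl_conj_mul g1 g2 g3, hb, hab, habc, hbc]
  linear_combination (-cl ℂ g3) * hsum
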